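/- Let p ≥ 1, {c_n} be a sequence of positive numbers, and {X_{n,j}, 1 ≤ j ≤ k_n, n ≥ 1} be an array of random variables satisfying the exponential-type maximal inequality (2.1) with nonnegative sequences {α_n}, {β_n} such that α_n = O(1) and β_n = O(1) as n → ∞. Assume (i') for all λ > 0, ∑_{n=1}^∞ c_n ∑_{j=1}^{k_n} P{|X_{n,j}| > λ} < ∞, and that there exists δ > 0 such that: (b') ∑_{j=1}^{k_n} P{|X_{n,j}| > δ} = o(1) as n → ∞; (c') ∑_{n=1}^∞ ∑_{j=1}^{k_n} c_n ∫_{δ^p}^∞ P{|X_{n,j}|^p > t} dt < ∞; (d') for some q > p, ∑_{n=1}^∞ c_n (∑_{j=1}^{k_n} Var(X_{n,j} 1_{{|X_{n,j}| ≤ δ}}))^q < ∞ and ∑_{n=1}^∞ c_n (∑_{j=1}^{k_n} E[|X_{n,j}| 1_{{|X_{n,j}| > δ}}])^q < ∞. Then for all ε > 0, ∑_{n=1}^∞ c_n E[(max_{1≤i≤k_n} |∑_{j=1}^i (X_{n,j} − E[X_{n,j} 1_{{|X_{n,j}| ≤ δ}}])| − ε)_+^p] < ∞. -/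

import Mathlib

open MeasureTheory Finset

/-- Truncation at level `ℓ`: `g_ℓ(x) = (x ∧ ℓ) ∨ (-ℓ)`. -/
noncomputable def truncAt (l x : ℝ) : ℝ := max (min x l) (-l)

/-- The exponential-type maximal inequality (2.1) for the array `X` with row lengths `k`
and nonnegative sequences `α`, `β`: there are constants `C₁, C₂ > 0`, not depending on
`n, ℓ, λ, η`, such that for every `n ≥ 1` and all `ℓ, λ, η > 0`,
`P{max_{1≤i≤kₙ} |∑_{j=1}^i [g_ℓ(X_{n,j}) − E g_ℓ(X_{n,j})]| ≥ λ}
  ≤ αₙ P{max_{1≤j≤kₙ} |g_ℓ(X_{n,j}) − E g_ℓ(X_{n,j})| > C₁ η}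
    + βₙ (∑_{j=1}^{kₙ} E (g_ℓ(X_{n,j}) − E g_ℓ(X_{n,j}))² / (C₂ λ η))^{λ/η}`. -/
def ExpMaxIneq {Ω : Type*} [MeasurableSpace Ω] (μ : Measure Ω)
    (k : ℕ → ℕ) (X : ℕ → ℕ → Ω → ℝ) (α β : ℕ → ℝ) : Prop :=
  ∃ C₁ > (0 : ℝ), ∃ C₂ > (0 : ℝ), ∀ n, 1 ≤ n → ∀ l > (0 : ℝ), ∀ lam > (0 : ℝ), ∀ η > (0 : ℝ),
    μ {ω | ∃ i ∈ Finset.Icc 1 (k n), lam ≤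
        |∑ j ∈ Finset.Icc 1 i, (truncAt l (X n j ω) - ∫ ω', truncAt l (X n j ω') ∂μ)|}
      ≤ ENNReal.ofReal (α n) *
          μ {ω | ∃ j ∈ Finset.Icc 1 (k n),
            C₁ * η < |truncAt l (X n j ω) - ∫ ω', truncAt l (X n j ω') ∂μ|}
        + ENNReal.ofReal (β n) *
          ENNReal.ofReal ((∑ j ∈ Finset.Icc 1 (k n),
              ∫ ω', (truncAt l (X n j ω') - ∫ ω'', truncAt l (X n j ω'') ∂μ) ^ 2 ∂μ) /
            (C₂ * lam * η)) ^ (lam / η)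

lemma exists_le_of_le_biSup {s : Finset ℕ} (hs : s.Nonempty) {F : ℕ → ℝ} (hF : ∀ i, 0 ≤ F i)
    {x : ℝ} (hx : x ≤ ⨆ i ∈ s, F i) : ∃ i ∈ s, x ≤ F i := by
  obtain ⟨m, hm, hmax⟩ := s.exists_max_image F hs
  exact ⟨m, hm, hx.trans (Real.iSup_le (fun i => Real.iSup_le (fun hi => hmax i hi) (hF m)) (hF m))⟩

lemma truncAt_eq_self {l x : ℝ} (h : |x| ≤ l) : truncAt l x = x := by
  obtain ⟨h1, h2⟩ := abs_le.mp h
  rw [truncAt, min_eq_left h2, max_eq_left h1]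

lemma abs_truncAt_le_level {l : ℝ} (hl : 0 ≤ l) (x : ℝ) : |truncAt l x| ≤ l := by
  unfold truncAt
  exact abs_le.mpr ⟨le_max_right _ _, max_le (min_le_right _ _) (by linarith)⟩

lemma abs_truncAt_le_abs {l : ℝ} (hl : 0 ≤ l) (x : ℝ) : |truncAt l x| ≤ |x| := by
  rcases le_or_gt |x| l with h | h
  · rw [truncAt_eq_self h]
  · exact (abs_truncAt_le_level hl x).trans h.le

lemma measurable_truncAt (l : ℝ) : Measurable (truncAt l) := by
  unfold truncAt
  fun_prop

lemma abs_truncAt_sub_ite_le {l δ : ℝ} (hδ : 0 < δ) (hl : δ ≤ l) (x : ℝ) :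
    |truncAt l x - if |x| ≤ δ then x else 0| ≤ if δ < |x| then |x| else 0 := by
  rcases le_or_gt |x| δ with h | h
  · rw [truncAt_eq_self (h.trans hl)]
    simp [h, h.not_gt]
  · simpa [h, h.not_ge] using abs_truncAt_le_abs (hδ.le.trans hl) x

lemma truncAt_sub_ite_sq_le {l δ : ℝ} (hδ : 0 < δ) (hl : δ ≤ l) (x : ℝ) :
    (truncAt l x - if |x| ≤ δ then x else 0) ^ 2 ≤ l * if δ < |x| then |x| else 0 := by
  rcases le_or_gt |x| δ with h | h
  · rw [truncAt_eq_self (h.trans hl)]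
    simp [h, h.not_gt]
  · have h1 := abs_truncAt_le_abs (hδ.le.trans hl) x
    have h2 := abs_truncAt_le_level (hδ.le.trans hl) x
    simp only [h, h.not_ge, if_true, if_false, sub_zero]
    rw [← sq_abs, sq]
    exact mul_le_mul h2 h1 (abs_nonneg _) (hδ.le.trans hl)

section SingleVariable

variable {Ω : Type*} [MeasurableSpace Ω] {μ : Measure Ω} {Y : Ω → ℝ} {l δ : ℝ}

lemma measurable_ite_abs_le (hY : Measurable Y) (δ : ℝ) :
    Measurable fun ω => if |Y ω| ≤ δ then Y ω else 0 :=
  Measurable.ite (measurableSet_le (by fun_prop) measurable_const) hY measurable_const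

lemma measurable_ite_lt_abs (hY : Measurable Y) (δ : ℝ) :
    Measurable fun ω => if δ < |Y ω| then |Y ω| else 0 :=
  Measurable.ite (measurableSet_lt measurable_const (by fun_prop)) (by fun_prop) measurable_const

lemma ite_lt_abs_nonneg (δ x : ℝ) : 0 ≤ if δ < |x| then |x| else 0 := by
  split_ifs <;> positivity

lemma integrable_ite_lt_abs (hY : Measurable Y)
    (h : ∫⁻ ω, ENNReal.ofReal (if δ < |Y ω| then |Y ω| else 0) ∂μ ≠ ⊤) :
    Integrable (fun ω => if δ < |Y ω| then |Y ω| else 0) μ :=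
  (lintegral_ofReal_ne_top_iff_integrable (measurable_ite_lt_abs hY δ).aestronglyMeasurable
    (Filter.Eventually.of_forall fun ω => ite_lt_abs_nonneg δ (Y ω))).mp h

lemma abs_ite_abs_le (hδ : 0 < δ) (x : ℝ) : |if |x| ≤ δ then x else 0| ≤ δ := by
  split_ifs with h
  · exact h
  · simpa using hδ.le

variable [IsProbabilityMeasure μ]

lemma integrable_of_measurable_of_abs_le {f : Ω → ℝ} (hf : Measurable f) {C : ℝ}
    (hC : ∀ ω, |f ω| ≤ C) : Integrable f μ :=
  Integrable.of_bound hf.aestronglyMeasurable C (Filter.Eventually.of_forall hC)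

lemma integrable_truncAt (hY : Measurable Y) (hl : 0 ≤ l) :
    Integrable (fun ω => truncAt l (Y ω)) μ :=
  integrable_of_measurable_of_abs_le ((measurable_truncAt l).comp hY)
    fun ω => abs_truncAt_le_level hl (Y ω)

lemma integrable_ite_abs_le (hY : Measurable Y) (hδ : 0 < δ) :
    Integrable (fun ω => if |Y ω| ≤ δ then Y ω else 0) μ :=
  integrable_of_measurable_of_abs_le (measurable_ite_abs_le hY δ)
    fun ω => abs_ite_abs_le hδ (Y ω)

lemma abs_integral_truncAt_sub_le (hY : Measurable Y) (hδ : 0 < δ) (hl : δ ≤ l)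
    (h : Integrable (fun ω => if δ < |Y ω| then |Y ω| else 0) μ) :
    |∫ ω, truncAt l (Y ω) ∂μ - ∫ ω, (if |Y ω| ≤ δ then Y ω else 0) ∂μ|
      ≤ ∫ ω, (if δ < |Y ω| then |Y ω| else 0) ∂μ := by
  rw [← integral_sub (integrable_truncAt hY (hδ.le.trans hl)) (integrable_ite_abs_le hY hδ)]
  refine norm_integral_le_of_norm_le
    (f := fun ω => truncAt l (Y ω) - if |Y ω| ≤ δ then Y ω else 0) h
    (Filter.Eventually.of_forall fun ω => ?_)
  exact abs_truncAt_sub_ite_le hδ hl (Y ω)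

lemma integral_centered_truncAt_sq_le (hY : Measurable Y) (hδ : 0 < δ) (hl : δ ≤ l)
    (h : Integrable (fun ω => if δ < |Y ω| then |Y ω| else 0) μ) :
    ∫ ω, (truncAt l (Y ω) - ∫ ω', truncAt l (Y ω') ∂μ) ^ 2 ∂μ
      ≤ 2 * ProbabilityTheory.variance (fun ω => if |Y ω| ≤ δ then Y ω else 0) μ
        + 2 * l * ∫ ω, (if δ < |Y ω| then |Y ω| else 0) ∂μ := by
  have hl0 : 0 ≤ l := hδ.le.trans hl
  have hg : Measurable fun ω => truncAt l (Y ω) := (measurable_truncAt l).comp hY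
  have hY' := measurable_ite_abs_le hY δ
  set m := ∫ ω, (if |Y ω| ≤ δ then Y ω else 0) ∂μ with hm
  have hm' : |m| ≤ δ := by
    have := norm_integral_le_of_norm_le_const (μ := μ) (C := δ)
      (f := fun ω => if |Y ω| ≤ δ then Y ω else 0)
      (Filter.Eventually.of_forall fun ω => abs_ite_abs_le hδ (Y ω))
    simpa using this
  have hint : Integrable (fun ω => ((if |Y ω| ≤ δ then Y ω else 0) - m) ^ 2) μ := by
    refine integrable_of_measurable_of_abs_le (C := (2 * δ) ^ 2) (by fun_prop) fun ω => ?_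
    rw [abs_pow]
    gcongr
    exact (abs_sub _ _).trans (by linarith [abs_ite_abs_le hδ (Y ω)])
  rw [← ProbabilityTheory.variance_eq_integral hg.aemeasurable,
    ProbabilityTheory.variance_eq_integral hY'.aemeasurable,
    ← ProbabilityTheory.variance_sub_const hg.aestronglyMeasurable m]
  refine (ProbabilityTheory.variance_le_expectation_sq
    (hg.sub_const m).aestronglyMeasurable).trans ?_
  rw [← integral_const_mul, ← integral_const_mul,
    ← integral_add (hint.const_mul 2) (h.const_mul (2 * l))]
  refine integral_mono_of_nonneg (Filter.Eventually.of_forall fun ω => sq_nonneg _)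
    ((hint.const_mul 2).add (h.const_mul (2 * l))) (Filter.Eventually.of_forall fun ω => ?_)
  have h1 := truncAt_sub_ite_sq_le hδ hl (Y ω)
  simp only [Pi.pow_apply]
  nlinarith [sq_nonneg ((truncAt l (Y ω) - if |Y ω| ≤ δ then Y ω else 0)
    - ((if |Y ω| ≤ δ then Y ω else 0) - m))]

lemma abs_integral_truncAt_le (hY : Measurable Y) (hl : 0 < l) {b : ℝ} (hb : 0 ≤ b) :
    |∫ ω, truncAt l (Y ω) ∂μ| ≤ b + l * μ.real {ω | b < |Y ω|} := by
  have hs : MeasurableSet {ω | b < |Y ω|} := measurableSet_lt measurable_const (by fun_prop)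
  have hi : Integrable (fun ω => b + Set.indicator {ω | b < |Y ω|} (fun _ => l) ω) μ :=
    (integrable_const b).add ((integrable_const l).indicator hs)
  have := norm_integral_le_of_norm_le hi (f := fun ω => truncAt l (Y ω))
    (Filter.Eventually.of_forall fun ω => by
      rw [Real.norm_eq_abs]
      by_cases h : b < |Y ω|
      · rw [Set.indicator_of_mem (by exact h)]
        linarith [abs_truncAt_le_level hl.le (Y ω)]
      · rw [Set.indicator_of_notMem (by exact h)]
        linarith [abs_truncAt_le_abs hl.le (Y ω), not_lt.mp h])
  rw [integral_add (integrable_const b) ((integrable_const l).indicator hs),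
    integral_indicator_const _ hs] at this
  simpa [mul_comm] using this

lemma measure_lt_abs_centered_truncAt_le (hY : Measurable Y) (hl : 0 < l) {b : ℝ} (hb : 0 < b) :
    μ {ω | 2 * b < |truncAt l (Y ω) - ∫ ω', truncAt l (Y ω') ∂μ|}
      ≤ ENNReal.ofReal (1 + 2 * l / b) * μ {ω | b / 2 < |Y ω|} := by
  rcases le_or_gt |∫ ω', truncAt l (Y ω') ∂μ| b with he | he
  · calc μ {ω | 2 * b < |truncAt l (Y ω) - ∫ ω', truncAt l (Y ω') ∂μ|}
        ≤ μ {ω | b / 2 < |Y ω|} := by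
          refine measure_mono fun ω hω => ?_
          simp only [Set.mem_ofPred_eq] at hω ⊢
          linarith [abs_sub (truncAt l (Y ω)) (∫ ω', truncAt l (Y ω') ∂μ),
            abs_truncAt_le_abs hl.le (Y ω)]
      _ ≤ _ := le_mul_of_one_le_left zero_le
          (ENNReal.one_le_ofReal.mpr (by linarith [show 0 ≤ 2 * l / b by positivity]))
  · refine prob_le_one.trans ?_
    rw [← ofReal_measureReal (measure_ne_top μ _), ← ENNReal.ofReal_mul (by positivity),
      ENNReal.one_le_ofReal]
    have h1 := abs_integral_truncAt_le (μ := μ) hY hl (half_pos hb).le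
    set P := μ.real {ω | b / 2 < |Y ω|}
    have hP : 0 ≤ P := measureReal_nonneg
    have h2 : 1 ≤ 2 * l / b * P := by
      rw [div_mul_eq_mul_div, le_div_iff₀ hb]
      linarith
    linarith

end SingleVariable

section TailIntegration

variable {Ω : Type*} [MeasurableSpace Ω] {μ : Measure Ω}

lemma setLIntegral_Ioi_add_right {f : ℝ → ENNReal} (hf : Measurable f) (c : ℝ) :
    ∫⁻ t in Set.Ioi 0, f (t + c) = ∫⁻ t in Set.Ioi c, f t := by
  have := (measurePreserving_add_right (volume : Measure ℝ) c).setLIntegral_comp_preimage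
    (measurableSet_Ioi (a := c)) hf
  rw [← this]
  congr 2
  ext t
  simp

lemma lintegral_rpow_sub_eq {Y : Ω → ℝ} (hY : Measurable Y) {p δ : ℝ} (hδ : 0 < δ) :
    ∫⁻ ω, ENNReal.ofReal (|Y ω| ^ p - δ ^ p) ∂μ
      = ∫⁻ t in Set.Ioi (δ ^ p), μ {ω | t < |Y ω| ^ p} := by
  have hδp : 0 ≤ δ ^ p := Real.rpow_nonneg hδ.le p
  have hanti : Antitone fun t : ℝ => μ {ω | t < |Y ω| ^ p} :=
    fun s t hst => measure_mono fun ω hω => lt_of_le_of_lt hst hω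
  rw [← setLIntegral_Ioi_add_right hanti.measurable]
  have := lintegral_eq_lintegral_meas_lt μ (f := fun ω => max (|Y ω| ^ p - δ ^ p) 0)
    (Filter.Eventually.of_forall fun ω => le_max_right _ _) (by fun_prop)
  simp only [ENNReal.ofReal_max, ENNReal.ofReal_zero, zero_le, max_eq_left] at this
  rw [this]
  refine setLIntegral_congr_fun measurableSet_Ioi fun t ht => ?_
  congr 1
  ext ω
  have ht' : ¬ t < 0 := not_lt.mpr (le_of_lt ht)
  simp [ht', lt_sub_iff_add_lt]

lemma tail_lintegral_le {Y : Ω → ℝ} (hY : Measurable Y) {p a ε δ : ℝ} (hp : 0 < p) (ha : 0 < a)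
    (hε : 0 < ε) (hδ : 0 < δ) :
    ENNReal.ofReal p *
        ∫⁻ t in Set.Ioi (0 : ℝ), μ {ω | a * (t + ε) < |Y ω|} * ENNReal.ofReal (t ^ (p - 1))
      ≤ ENNReal.ofReal ((a ^ p)⁻¹) * (ENNReal.ofReal (δ ^ p) * μ {ω | a * ε < |Y ω|}
        + ∫⁻ t in Set.Ioi (δ ^ p), μ {ω | t < |Y ω| ^ p}) := by
  have hap : 0 < a ^ p := Real.rpow_pos_of_pos ha p
  have hs : MeasurableSet {ω | a * ε < |Y ω|} := measurableSet_lt measurable_const (by fun_prop)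
  have key := lintegral_rpow_eq_lintegral_meas_lt_mul μ (f := fun ω => max (|Y ω| / a - ε) 0)
    (Filter.Eventually.of_forall fun ω => le_max_right _ _) (by fun_prop) hp
  have hset : ∫⁻ t in Set.Ioi (0 : ℝ), μ {ω | a * (t + ε) < |Y ω|} * ENNReal.ofReal (t ^ (p - 1))
      = ∫⁻ t in Set.Ioi (0 : ℝ), μ {ω | t < max (|Y ω| / a - ε) 0}
          * ENNReal.ofReal (t ^ (p - 1)) := by
    refine setLIntegral_congr_fun measurableSet_Ioi fun t ht => ?_
    have ht' : ¬ t < 0 := not_lt.mpr (le_of_lt ht)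
    have hiff : ∀ x : ℝ, a * (t + ε) < x ↔ t < x / a - ε := fun x => by
      rw [lt_sub_iff_add_lt, lt_div_iff₀ ha, mul_comm]
    simp only [lt_max_iff, ht', or_false, hiff]
  rw [hset, ← key, ← lintegral_rpow_sub_eq hY hδ, ← lintegral_indicator_const hs,
    ← lintegral_add_left (measurable_const.indicator hs), ← lintegral_const_mul _ (by fun_prop)]
  refine lintegral_mono fun ω => ?_
  simp only []
  by_cases h : a * ε < |Y ω|
  · rw [Set.indicator_of_mem (by exact h)]
    have h1 : max (|Y ω| / a - ε) 0 ^ p ≤ (a ^ p)⁻¹ * |Y ω| ^ p := by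
      rw [inv_mul_eq_div, ← Real.div_rpow (abs_nonneg _) ha.le]
      refine Real.rpow_le_rpow (le_max_right _ _) (max_le ?_ ?_) hp.le
      · linarith
      · positivity
    refine (ENNReal.ofReal_le_ofReal h1).trans ?_
    rw [ENNReal.ofReal_mul (by positivity)]
    gcongr
    refine le_trans (ENNReal.ofReal_le_ofReal ?_) ENNReal.ofReal_add_le
    linarith
  · have : |Y ω| / a - ε ≤ 0 := by
      rw [sub_nonpos, div_le_iff₀ ha]
      linarith
    rw [max_eq_right this, Real.zero_rpow hp.ne']
    simp

lemma power_tail_lintegral_lt_top {p q ε : ℝ} (hpq : p < q) (hp : 1 ≤ p) (hε : 0 < ε) :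
    ∫⁻ t in Set.Ioi (0 : ℝ), ENNReal.ofReal ((t + ε) ^ (-q)) * ENNReal.ofReal (t ^ (p - 1))
      < ⊤ := by
  have hi := integrableOn_add_rpow_Ioi_of_lt (a := p - 1 - q) (c := 0) (m := ε) (by linarith)
    (by linarith)
  refine lt_of_le_of_lt (setLIntegral_mono' measurableSet_Ioi fun t ht => ?_)
    hi.setLIntegral_lt_top
  have ht0 : 0 < t := ht
  rw [← ENNReal.ofReal_mul (by positivity)]
  refine ENNReal.ofReal_le_ofReal ?_
  calc (t + ε) ^ (-q) * t ^ (p - 1) ≤ (t + ε) ^ (-q) * (t + ε) ^ (p - 1) := by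
        gcongr
        linarith
    _ = (t + ε) ^ (p - 1 - q) := by
        rw [← Real.rpow_add (by positivity)]
        ring_nf

/-- A tail bound at all levels above `ε` yields a bound for the `p`-th moment of the excess
over `ε`. -/
lemma lintegral_excess_rpow_le {p q a ε δ : ℝ} (hp : 1 ≤ p) (ha : 0 < a)
    (hε : 0 < ε) (hδ : 0 < δ) {s : Finset ℕ} {Y : ℕ → Ω → ℝ} (hY : ∀ j ∈ s, Measurable (Y j))
    {M : Ω → ℝ} (hM : Measurable M) {A B : ENNReal}
    (htail : ∀ x, ε ≤ x → μ {ω | x ≤ M ω}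
      ≤ A * ∑ j ∈ s, μ {ω | a * x < |Y j ω|} + B * ENNReal.ofReal (x ^ (-q))) :
    ∫⁻ ω, ENNReal.ofReal (M ω - ε) ^ p ∂μ
      ≤ A * ∑ j ∈ s, ENNReal.ofReal ((a ^ p)⁻¹) * (ENNReal.ofReal (δ ^ p) * μ {ω | a * ε < |Y j ω|}
          + ∫⁻ t in Set.Ioi (δ ^ p), μ {ω | t < |Y j ω| ^ p})
        + B * (ENNReal.ofReal p * ∫⁻ t in Set.Ioi (0 : ℝ),
          ENNReal.ofReal ((t + ε) ^ (-q)) * ENNReal.ofReal (t ^ (p - 1))) := by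
  have hp0 : 0 < p := by linarith
  have key := lintegral_rpow_eq_lintegral_meas_le_mul μ (f := fun ω => max (M ω - ε) 0)
    (Filter.Eventually.of_forall fun ω => le_max_right _ _) (by fun_prop) hp0
  have hL : ∫⁻ ω, ENNReal.ofReal (M ω - ε) ^ p ∂μ
      = ∫⁻ ω, ENNReal.ofReal (max (M ω - ε) 0 ^ p) ∂μ := by
    refine lintegral_congr fun ω => ?_
    rw [← ENNReal.ofReal_rpow_of_nonneg (le_max_right _ _) hp0.le, ENNReal.ofReal_max]
    simp
  have hmeas : ∀ j, Measurable fun t : ℝ => μ {ω | a * (t + ε) < |Y j ω|} := fun j =>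
    Antitone.measurable fun s t hst => measure_mono fun ω hω =>
      lt_of_le_of_lt (by gcongr) (by exact hω : a * (t + ε) < |Y j ω|)
  rw [hL, key]
  calc ENNReal.ofReal p * ∫⁻ t in Set.Ioi (0 : ℝ),
          μ {ω | t ≤ max (M ω - ε) 0} * ENNReal.ofReal (t ^ (p - 1))
      ≤ ENNReal.ofReal p * ∫⁻ t in Set.Ioi (0 : ℝ),
          (A * ∑ j ∈ s, μ {ω | a * (t + ε) < |Y j ω|} * ENNReal.ofReal (t ^ (p - 1))
          + B * (ENNReal.ofReal ((t + ε) ^ (-q)) * ENNReal.ofReal (t ^ (p - 1)))) := by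
        gcongr ENNReal.ofReal p * ?_
        refine setLIntegral_mono' measurableSet_Ioi fun t ht => ?_
        have ht0 : 0 < t := ht
        rw [← Finset.sum_mul, ← mul_assoc, ← mul_assoc, ← add_mul]
        gcongr
        refine le_trans (measure_mono fun ω hω => ?_) (htail (t + ε) (by linarith))
        have : t ≤ M ω - ε := (le_max_iff.mp hω).resolve_right (not_le.mpr ht0)
        simp only [Set.mem_ofPred_eq]
        linarith
    _ = A * ∑ j ∈ s, ENNReal.ofReal p * (∫⁻ t in Set.Ioi (0 : ℝ),
            μ {ω | a * (t + ε) < |Y j ω|} * ENNReal.ofReal (t ^ (p - 1)))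
        + B * (ENNReal.ofReal p * ∫⁻ t in Set.Ioi (0 : ℝ),
          ENNReal.ofReal ((t + ε) ^ (-q)) * ENNReal.ofReal (t ^ (p - 1))) := by
        have hm : ∀ j, Measurable fun t : ℝ =>
            μ {ω | a * (t + ε) < |Y j ω|} * ENNReal.ofReal (t ^ (p - 1)) :=
          fun j => (hmeas j).mul (by fun_prop)
        rw [lintegral_add_right _ (by fun_prop), lintegral_const_mul _ (by fun_prop),
          lintegral_const_mul _ (by fun_prop), lintegral_finsetSum _ (fun j _ => hm j),
          ← Finset.mul_sum]
        ring
    _ ≤ _ := by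
        gcongr A * ∑ j ∈ s, ?_ + _ with j hj
        exact tail_lintegral_le (hY j hj) hp0 ha hε hδ

end TailIntegration

section RowTail

variable {Ω : Type*} [MeasurableSpace Ω] {μ : Measure Ω}

lemma measurable_biSup_abs_partialSum {N : ℕ} {Y : ℕ → Ω → ℝ}
    (hY : ∀ j ∈ Icc 1 N, Measurable (Y j)) (m : ℕ → ℝ) :
    Measurable fun ω => ⨆ i ∈ Icc 1 N, |∑ j ∈ Icc 1 i, (Y j ω - m j)| := by
  refine Measurable.iSup fun i => Measurable.iSup fun hi => ?_
  have : Measurable fun ω => ∑ j ∈ Icc 1 i, (Y j ω - m j) :=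
    Finset.measurable_fun_sum _ fun j hj =>
      (hY j (Icc_subset_Icc_right (mem_Icc.mp hi).2 hj)).sub_const _
  fun_prop

lemma measure_exists_mem_le (s : Finset ℕ) (P : ℕ → Ω → Prop) :
    μ {ω | ∃ j ∈ s, P j ω} ≤ ∑ j ∈ s, μ {ω | P j ω} := by
  refine le_trans (measure_mono fun ω hω => ?_) (measure_biUnion_finset_le s _)
  obtain ⟨j, hj, h⟩ := hω
  exact Set.mem_biUnion hj h

lemma one_le_rpow_mul_ofReal_rpow_neg {x y q : ℝ} (hx : 0 < x) (hxy : x ≤ y) (hq : 0 ≤ q) :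
    1 ≤ ENNReal.ofReal y ^ q * ENNReal.ofReal (x ^ (-q)) := by
  have hy : 0 < y := hx.trans_le hxy
  rw [ENNReal.ofReal_rpow_of_pos hy, ← ENNReal.ofReal_mul (by positivity),
    ENNReal.one_le_ofReal]
  calc (1 : ℝ) = x ^ q * x ^ (-q) := by rw [← Real.rpow_add hx]; simp
    _ ≤ y ^ q * x ^ (-q) := by gcongr

/-- A tail bound that needs no maximal inequality, with constants depending on the row. -/
lemma measure_biSup_abs_partialSum_ge_le_of_card {N : ℕ} (hN : 1 ≤ N) {Y : ℕ → Ω → ℝ}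
    [IsProbabilityMeasure μ] {m : ℕ → ℝ} {δ : ℝ} (hm : ∀ j, |m j| ≤ δ) {q x : ℝ}
    (hq : 0 ≤ q) (hx : 0 < x) :
    μ {ω | x ≤ ⨆ i ∈ Icc 1 N, |∑ j ∈ Icc 1 i, (Y j ω - m j)|}
      ≤ 1 * ∑ j ∈ Icc 1 N, μ {ω | (3 * N : ℝ)⁻¹ * x < |Y j ω|}
        + ENNReal.ofReal (2 * N * δ) ^ q * ENNReal.ofReal (x ^ (-q)) := by
  have hN0 : (0 : ℝ) < N := by exact_mod_cast hN
  rcases le_or_gt x (2 * N * δ) with hx' | hx'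
  · exact prob_le_one.trans ((one_le_rpow_mul_ofReal_rpow_neg hx hx' hq).trans le_add_self)
  · rw [one_mul]
    refine le_trans ?_ le_self_add
    refine le_trans (measure_mono fun ω hω => ?_) (measure_exists_mem_le _ _)
    obtain ⟨i, hi, hle⟩ := exists_le_of_le_biSup (nonempty_Icc.mpr hN) (fun i => abs_nonneg _) hω
    by_contra hcon
    simp only [Set.mem_ofPred_eq, not_exists, not_and, not_lt] at hcon
    have h1 : |∑ j ∈ Icc 1 i, (Y j ω - m j)| ≤ ∑ j ∈ Icc 1 N, ((3 * N : ℝ)⁻¹ * x + δ) := by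
      have hsub := Icc_subset_Icc_right (a := 1) (mem_Icc.mp hi).2
      refine (abs_sum_le_sum_abs _ _).trans ((sum_le_sum_of_subset_of_nonneg hsub
        fun _ _ _ => abs_nonneg _).trans (sum_le_sum fun j hj => ?_))
      exact (abs_sub _ _).trans (add_le_add (hcon j hj) (hm j))
    have h2 : ∑ j ∈ Icc 1 N, ((3 * N : ℝ)⁻¹ * x + δ) = x / 3 + N * δ := by
      simp
      field_simp
    linarith

/-- The row-wise tail bound derived from the exponential maximal inequality. -/
lemma measure_biSup_abs_partialSum_ge_le [IsProbabilityMeasure μ] {N : ℕ} (hN : 1 ≤ N)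
    {Y : ℕ → Ω → ℝ} (hY : ∀ j ∈ Icc 1 N, Measurable (Y j)) {C₁ C₂ α β : ℝ} (hC₁ : 0 < C₁)
    (hC₂ : 0 < C₂)
    (hineq : ∀ l > (0 : ℝ), ∀ lam > (0 : ℝ), ∀ η > (0 : ℝ),
      μ {ω | ∃ i ∈ Finset.Icc 1 N, lam ≤
          |∑ j ∈ Finset.Icc 1 i, (truncAt l (Y j ω) - ∫ ω', truncAt l (Y j ω') ∂μ)|}
        ≤ ENNReal.ofReal α *
            μ {ω | ∃ j ∈ Finset.Icc 1 N,
              C₁ * η < |truncAt l (Y j ω) - ∫ ω', truncAt l (Y j ω') ∂μ|}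
          + ENNReal.ofReal β *
            ENNReal.ofReal ((∑ j ∈ Finset.Icc 1 N,
                ∫ ω', (truncAt l (Y j ω') - ∫ ω'', truncAt l (Y j ω'') ∂μ) ^ 2 ∂μ) /
              (C₂ * lam * η)) ^ (lam / η))
    {δ ε q : ℝ} (hδ : 0 < δ) (hε : 0 < ε) (hq : 1 ≤ q)
    (hfin : ∀ j ∈ Icc 1 N, ∫⁻ ω, ENNReal.ofReal (if δ < |Y j ω| then |Y j ω| else 0) ∂μ ≠ ⊤)
    {x : ℝ} (hx : ε ≤ x) :
    μ {ω | x ≤ ⨆ i ∈ Icc 1 N, |∑ j ∈ Icc 1 i,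
        (Y j ω - ∫ ω', (if |Y j ω'| ≤ δ then Y j ω' else 0) ∂μ)|}
      ≤ (1 + ENNReal.ofReal α * ENNReal.ofReal (1 + 8 * q * max 1 (δ / ε) / C₁))
          * ∑ j ∈ Icc 1 N, μ {ω | min 1 (C₁ / (8 * q)) * x < |Y j ω|}
        + ((2 ^ q + ENNReal.ofReal β *
              (ENNReal.ofReal (8 * q / C₂ * (1 / ε + max 1 (δ / ε))) ^ q * 2 ^ (q - 1)))
            * (ENNReal.ofReal (∑ j ∈ Icc 1 N,
                ProbabilityTheory.variance (fun ω => if |Y j ω| ≤ δ then Y j ω else 0) μ) ^ q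
              + (∑ j ∈ Icc 1 N,
                ∫⁻ ω, ENNReal.ofReal (if δ < |Y j ω| then |Y j ω| else 0) ∂μ) ^ q))
          * ENNReal.ofReal (x ^ (-q)) := by
  have hx0 : 0 < x := hε.trans_le hx
  have hq0 : 0 < q := by linarith
  set K := max 1 (δ / ε)
  have hK1 : 1 ≤ K := le_max_left _ _
  have hK0 : 0 < K := by linarith
  have hl : 0 < K * x := by positivity
  have hδl : δ ≤ K * x :=
    calc δ = δ / ε * ε := by field_simp
      _ ≤ K * x := by gcongr; exact le_max_right _ _
  have hxl : x ≤ K * x := by nlinarith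
  have hint : ∀ j ∈ Icc 1 N, Integrable (fun ω => if δ < |Y j ω| then |Y j ω| else 0) μ :=
    fun j hj => integrable_ite_lt_abs (hY j hj) (hfin j hj)
  set w : ℝ := ∑ j ∈ Icc 1 N, ∫ ω, (if δ < |Y j ω| then |Y j ω| else 0) ∂μ with hw
  have hwj : ∀ j, 0 ≤ ∫ ω, (if δ < |Y j ω| then |Y j ω| else 0) ∂μ :=
    fun j => integral_nonneg fun ω => ite_lt_abs_nonneg δ (Y j ω)
  have hw0 : 0 ≤ w := sum_nonneg fun j _ => hwj j
  have hW : ∑ j ∈ Icc 1 N, ∫⁻ ω, ENNReal.ofReal (if δ < |Y j ω| then |Y j ω| else 0) ∂μ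
      = ENNReal.ofReal w := by
    rw [hw, ENNReal.ofReal_sum_of_nonneg fun j _ => hwj j]
    exact sum_congr rfl fun j hj => (ofReal_integral_eq_lintegral_ofReal (hint j hj)
      (Filter.Eventually.of_forall fun ω => ite_lt_abs_nonneg δ (Y j ω))).symm
  set V : ℝ := ∑ j ∈ Icc 1 N,
    ProbabilityTheory.variance (fun ω => if |Y j ω| ≤ δ then Y j ω else 0) μ with hV
  have hV0 : 0 ≤ V := sum_nonneg fun j _ => ProbabilityTheory.variance_nonneg _ _
  rw [hW]
  rcases lt_or_ge x (2 * w) with hcase | hcase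
  · refine prob_le_one.trans ((one_le_rpow_mul_ofReal_rpow_neg hx0 hcase.le hq0.le).trans
      (le_trans ?_ le_add_self))
    gcongr ?_ * _
    rw [ENNReal.ofReal_mul (by norm_num), ENNReal.mul_rpow_of_nonneg _ _ hq0.le,
      ENNReal.ofReal_ofNat]
    exact mul_le_mul' le_self_add le_add_self
  have hcover : μ {ω | x ≤ ⨆ i ∈ Icc 1 N, |∑ j ∈ Icc 1 i,
        (Y j ω - ∫ ω', (if |Y j ω'| ≤ δ then Y j ω' else 0) ∂μ)|}
      ≤ μ {ω | ∃ j ∈ Icc 1 N, K * x < |Y j ω|}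
        + μ {ω | ∃ i ∈ Icc 1 N, x / 2 ≤
          |∑ j ∈ Icc 1 i, (truncAt (K * x) (Y j ω) - ∫ ω', truncAt (K * x) (Y j ω') ∂μ)|} := by
    refine le_trans (measure_mono fun ω hω => ?_) (measure_union_le _ _)
    obtain ⟨i, hi, hle⟩ := exists_le_of_le_biSup (nonempty_Icc.mpr hN) (fun i => abs_nonneg _) hω
    by_cases hbig : ∃ j ∈ Icc 1 N, K * x < |Y j ω|
    · exact Or.inl hbig
    · refine Or.inr ⟨i, hi, ?_⟩
      push Not at hbig
      have hsub := Icc_subset_Icc_right (a := 1) (mem_Icc.mp hi).2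
      have hsplit : ∑ j ∈ Icc 1 i, (Y j ω - ∫ ω', (if |Y j ω'| ≤ δ then Y j ω' else 0) ∂μ)
          = ∑ j ∈ Icc 1 i, (truncAt (K * x) (Y j ω) - ∫ ω', truncAt (K * x) (Y j ω') ∂μ)
            + ∑ j ∈ Icc 1 i, (∫ ω', truncAt (K * x) (Y j ω') ∂μ
              - ∫ ω', (if |Y j ω'| ≤ δ then Y j ω' else 0) ∂μ) := by
        rw [← sum_add_distrib]
        refine sum_congr rfl fun j hj => ?_
        rw [truncAt_eq_self (hbig j (hsub hj))]
        ring
      have hcenter : |∑ j ∈ Icc 1 i, (∫ ω', truncAt (K * x) (Y j ω') ∂μ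
              - ∫ ω', (if |Y j ω'| ≤ δ then Y j ω' else 0) ∂μ)| ≤ w :=
        (abs_sum_le_sum_abs _ _).trans ((sum_le_sum_of_subset_of_nonneg hsub
          fun _ _ _ => abs_nonneg _).trans (sum_le_sum fun j hj =>
            abs_integral_truncAt_sub_le (hY j hj) hδ hδl (hint j hj)))
      rw [hsplit] at hle
      linarith [abs_add_le (∑ j ∈ Icc 1 i, (truncAt (K * x) (Y j ω)
        - ∫ ω', truncAt (K * x) (Y j ω') ∂μ)) (∑ j ∈ Icc 1 i, (∫ ω', truncAt (K * x) (Y j ω') ∂μ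
              - ∫ ω', (if |Y j ω'| ≤ δ then Y j ω' else 0) ∂μ))]
  have hmax := hineq (K * x) hl (x / 2) (by positivity) (x / (2 * q)) (by positivity)
  have hexp : x / 2 / (x / (2 * q)) = q := by field_simp
  rw [hexp] at hmax
  set a := min 1 (C₁ / (8 * q))
  have hfirst : μ {ω | ∃ j ∈ Icc 1 N, K * x < |Y j ω|}
      ≤ ∑ j ∈ Icc 1 N, μ {ω | a * x < |Y j ω|} := by
    refine (measure_exists_mem_le _ _).trans (sum_le_sum fun j _ => measure_mono fun ω hω => ?_)
    refine lt_of_le_of_lt ?_ (by exact hω : K * x < |Y j ω|)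
    gcongr
    exact (min_le_left _ _).trans hK1
  have hsecond : μ {ω | ∃ j ∈ Finset.Icc 1 N,
        C₁ * (x / (2 * q)) < |truncAt (K * x) (Y j ω) - ∫ ω', truncAt (K * x) (Y j ω') ∂μ|}
      ≤ ENNReal.ofReal (1 + 8 * q * K / C₁) * ∑ j ∈ Icc 1 N, μ {ω | a * x < |Y j ω|} := by
    refine (measure_exists_mem_le _ _).trans ?_
    rw [mul_sum]
    refine sum_le_sum fun j hj => ?_
    have h := measure_lt_abs_centered_truncAt_le (μ := μ) (hY j hj) hl
      (b := C₁ * x / (4 * q)) (by positivity)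
    have e1 : 2 * (C₁ * x / (4 * q)) = C₁ * (x / (2 * q)) := by field_simp; norm_num
    have e2 : 2 * (K * x) / (C₁ * x / (4 * q)) = 8 * q * K / C₁ := by field_simp; norm_num
    rw [e1, e2] at h
    refine h.trans ?_
    gcongr _ * ?_
    refine measure_mono fun ω hω => lt_of_le_of_lt ?_
      (by exact hω : C₁ * x / (4 * q) / 2 < |Y j ω|)
    calc a * x ≤ C₁ / (8 * q) * x := by gcongr; exact min_le_right _ _
      _ = C₁ * x / (4 * q) / 2 := by field_simp; norm_num
  have hsum : (∑ j ∈ Finset.Icc 1 N, ∫ ω', (truncAt (K * x) (Y j ω')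
        - ∫ ω'', truncAt (K * x) (Y j ω'') ∂μ) ^ 2 ∂μ) / (C₂ * (x / 2) * (x / (2 * q)))
      ≤ 8 * q / C₂ * (1 / ε + K) * (V + w) * x⁻¹ := by
    have h1 : ∑ j ∈ Finset.Icc 1 N, ∫ ω', (truncAt (K * x) (Y j ω')
        - ∫ ω'', truncAt (K * x) (Y j ω'') ∂μ) ^ 2 ∂μ ≤ 2 * V + 2 * (K * x) * w := by
      rw [hV, hw, mul_sum, mul_sum, ← sum_add_distrib]
      exact sum_le_sum fun j hj => integral_centered_truncAt_sq_le (hY j hj) hδ hδl (hint j hj)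
    calc _ ≤ (2 * V + 2 * (K * x) * w) / (C₂ * (x / 2) * (x / (2 * q))) := by gcongr
      _ = 8 * q / C₂ * (1 / x * V + K * w) * x⁻¹ := by field_simp; ring
      _ ≤ 8 * q / C₂ * (1 / ε * V + K * w) * x⁻¹ := by gcongr
      _ ≤ 8 * q / C₂ * ((1 / ε + K) * (V + w)) * x⁻¹ := by
          gcongr
          have : 0 ≤ 1 / ε * w := by positivity
          nlinarith [mul_nonneg hK0.le hV0]
      _ = _ := by ring
  have hthird : ENNReal.ofReal ((∑ j ∈ Finset.Icc 1 N, ∫ ω', (truncAt (K * x) (Y j ω')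
        - ∫ ω'', truncAt (K * x) (Y j ω'') ∂μ) ^ 2 ∂μ) / (C₂ * (x / 2) * (x / (2 * q)))) ^ q
      ≤ ENNReal.ofReal (8 * q / C₂ * (1 / ε + K)) ^ q * 2 ^ (q - 1)
          * (ENNReal.ofReal V ^ q + ENNReal.ofReal w ^ q) * ENNReal.ofReal (x ^ (-q)) := by
    refine (ENNReal.rpow_le_rpow (ENNReal.ofReal_le_ofReal hsum) hq0.le).trans ?_
    rw [ENNReal.ofReal_mul (by positivity), ENNReal.ofReal_mul (by positivity),
      ENNReal.mul_rpow_of_nonneg _ _ hq0.le, ENNReal.mul_rpow_of_nonneg _ _ hq0.le,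
      ENNReal.ofReal_add hV0 hw0,
      ENNReal.ofReal_rpow_of_nonneg (inv_nonneg.mpr hx0.le) hq0.le,
      Real.inv_rpow hx0.le, ← Real.rpow_neg hx0.le, mul_assoc (_ ^ q) (2 ^ (q - 1))]
    gcongr
    exact ENNReal.rpow_add_le_mul_rpow_add_rpow _ _ hq
  calc _ ≤ _ := hcover
    _ ≤ _ := add_le_add hfirst (hmax.trans (add_le_add (mul_le_mul_right hsecond _)
        (mul_le_mul_right hthird _)))
    _ ≤ (1 + ENNReal.ofReal α * ENNReal.ofReal (1 + 8 * q * K / C₁))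
          * ∑ j ∈ Icc 1 N, μ {ω | a * x < |Y j ω|}
        + ENNReal.ofReal β * (ENNReal.ofReal (8 * q / C₂ * (1 / ε + K)) ^ q * 2 ^ (q - 1))
            * (ENNReal.ofReal V ^ q + ENNReal.ofReal w ^ q) * ENNReal.ofReal (x ^ (-q)) := by
        apply le_of_eq
        ring
    _ ≤ _ := by
        gcongr
        exact le_add_self

end RowTail

/-- Corollary 1: convergence of the series of moments under bounded `αₙ`, `βₙ` and
assumptions (i'), (b'), (c'), (d'). -/
theorem corollary1 {Ω : Type*} [MeasurableSpace Ω] (μ : Measure Ω) [IsProbabilityMeasure μ]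
    (p : ℝ) (hp : 1 ≤ p)
    (k : ℕ → ℕ) (hk1 : ∀ n, 1 ≤ k n) (hk : Filter.Tendsto k Filter.atTop Filter.atTop)
    (X : ℕ → ℕ → Ω → ℝ) (hmeas : ∀ n j, j ∈ Finset.Icc 1 (k n) → Measurable (X n j))
    (c α β : ℕ → ℝ) (hc : ∀ n, 0 < c n) (hα : ∀ n, 0 ≤ α n) (hβ : ∀ n, 0 ≤ β n)
    (hαO : α =O[Filter.atTop] (fun _ => (1 : ℝ)))
    (hβO : β =O[Filter.atTop] (fun _ => (1 : ℝ)))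
    (hineq : ExpMaxIneq μ k X α β)
    -- (i')
    (hi : ∀ lam > (0 : ℝ),
      (∑' n, ENNReal.ofReal (c n) *
        ∑ j ∈ Finset.Icc 1 (k n), μ {ω | lam < |X n j ω|}) < ⊤)
    (δ : ℝ) (hδ : 0 < δ)
    -- (b')
    (hb' : Filter.Tendsto
      (fun n => ∑ j ∈ Finset.Icc 1 (k n), μ {ω | δ < |X n j ω|})
      Filter.atTop (nhds 0))
    -- (c')
    (hc' : (∑' n, ∑ j ∈ Finset.Icc 1 (k n), ENNReal.ofReal (c n) *
        ∫⁻ t in Set.Ioi (δ ^ p), μ {ω | t < |X n j ω| ^ p}) < ⊤)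
    -- (d')
    (q : ℝ) (hq : p < q)
    (hd₁ : (∑' n, ENNReal.ofReal (c n *
        (∑ j ∈ Finset.Icc 1 (k n),
          ProbabilityTheory.variance (fun ω => if |X n j ω| ≤ δ then X n j ω else 0) μ) ^ q))
      < ⊤)
    (hd₂ : (∑' n, ENNReal.ofReal (c n) *
        (∑ j ∈ Finset.Icc 1 (k n),
          ∫⁻ ω, ENNReal.ofReal (if δ < |X n j ω| then |X n j ω| else 0) ∂μ) ^ q) < ⊤) :
    ∀ ε > (0 : ℝ),
      (∑' n, ENNReal.ofReal (c n) *
        ∫⁻ ω, (ENNReal.ofReal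
          ((⨆ i ∈ Finset.Icc 1 (k n),
            |∑ j ∈ Finset.Icc 1 i,
              (X n j ω - ∫ ω', (if |X n j ω'| ≤ δ then X n j ω' else 0) ∂μ)|) - ε)) ^ p ∂μ)
      < ⊤ := by
  intro ε hε
  obtain ⟨C₁, hC₁, C₂, hC₂, hmax⟩ := hineq
  obtain ⟨Ca, hCa⟩ := Asymptotics.isBigO_one_nat_atTop_iff.mp hαO
  obtain ⟨Cb, hCb⟩ := Asymptotics.isBigO_one_nat_atTop_iff.mp hβO
  have hp0 : 0 < p := by linarith
  have hq1 : 1 ≤ q := by linarith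
  have hq0 : 0 < q := by linarith
  have hc0 : ∀ n, ENNReal.ofReal (c n) ≠ 0 := fun n => (ENNReal.ofReal_pos.mpr (hc n)).ne'
  set W : ℕ → ENNReal := fun n => ∑ j ∈ Icc 1 (k n),
    ∫⁻ ω, ENNReal.ofReal (if δ < |X n j ω| then |X n j ω| else 0) ∂μ
  set V : ℕ → ℝ := fun n => ∑ j ∈ Icc 1 (k n),
    ProbabilityTheory.variance (fun ω => if |X n j ω| ≤ δ then X n j ω else 0) μ
  have hV0 : ∀ n, 0 ≤ V n := fun n => sum_nonneg fun j _ => ProbabilityTheory.variance_nonneg _ _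
  have hWfin : ∀ n, W n ≠ ⊤ := fun n hn => by
    refine ENNReal.ne_top_of_tsum_ne_top hd₂.ne n ?_
    change ENNReal.ofReal (c n) * W n ^ q = ⊤
    rw [hn, ENNReal.top_rpow_of_pos hq0, ENNReal.mul_top (hc0 n)]
  set J : ENNReal := ENNReal.ofReal p * ∫⁻ t in Set.Ioi (0 : ℝ),
    ENNReal.ofReal ((t + ε) ^ (-q)) * ENNReal.ofReal (t ^ (p - 1))
  have hJtop : J ≠ ⊤ :=
    ENNReal.mul_ne_top ENNReal.ofReal_ne_top (power_tail_lintegral_lt_top hq hp hε).ne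
  set m : ℕ → ℕ → ℝ := fun n j => ∫ ω', (if |X n j ω'| ≤ δ then X n j ω' else 0) ∂μ
  have hmle : ∀ n j, |m n j| ≤ δ := fun n j => by
    have := norm_integral_le_of_norm_le_const (μ := μ) (C := δ)
      (f := fun ω => if |X n j ω| ≤ δ then X n j ω else 0)
      (Filter.Eventually.of_forall fun ω => abs_ite_abs_le hδ (X n j ω))
    simpa using this
  set F : ℕ → ENNReal := fun n => ENNReal.ofReal (c n) * ∫⁻ ω, (ENNReal.ofReal
    ((⨆ i ∈ Icc 1 (k n), |∑ j ∈ Icc 1 i, (X n j ω - m n j)|) - ε)) ^ p ∂μ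
  change ∑' n, F n < ⊤
  set R : ℝ → ℕ → ENNReal := fun a n => ∑ j ∈ Icc 1 (k n), ENNReal.ofReal ((a ^ p)⁻¹) *
    (ENNReal.ofReal (δ ^ p) * μ {ω | a * ε < |X n j ω|}
      + ∫⁻ t in Set.Ioi (δ ^ p), μ {ω | t < |X n j ω| ^ p}) with hR
  have hRsum : ∀ a > 0, ∑' n, ENNReal.ofReal (c n) * R a n ≠ ⊤ := fun a ha => by
    have heq : ∀ n, ENNReal.ofReal (c n) * R a n = ENNReal.ofReal ((a ^ p)⁻¹) *
        (ENNReal.ofReal (δ ^ p) *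
            (ENNReal.ofReal (c n) * ∑ j ∈ Icc 1 (k n), μ {ω | a * ε < |X n j ω|})
          + ∑ j ∈ Icc 1 (k n), ENNReal.ofReal (c n) *
            ∫⁻ t in Set.Ioi (δ ^ p), μ {ω | t < |X n j ω| ^ p}) := fun n => by
      simp only [hR, ← mul_sum, sum_add_distrib]
      ring
    simp only [heq]
    rw [ENNReal.tsum_mul_left, ENNReal.tsum_add, ENNReal.tsum_mul_left]
    exact ENNReal.mul_ne_top ENNReal.ofReal_ne_top (ENNReal.add_ne_top.mpr
      ⟨ENNReal.mul_ne_top ENNReal.ofReal_ne_top (hi (a * ε) (by positivity)).ne, hc'.ne⟩)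
  have hmeasM : ∀ n, Measurable fun ω =>
      ⨆ i ∈ Icc 1 (k n), |∑ j ∈ Icc 1 i, (X n j ω - m n j)| :=
    fun n => measurable_biSup_abs_partialSum (hmeas n) (m n)
  -- the row `n = 0`, for which the maximal inequality is not assumed
  have hF0 : F 0 ≠ ⊤ := by
    have hk0 : (0 : ℝ) < k 0 := by exact_mod_cast hk1 0
    have ha : (0 : ℝ) < (3 * k 0 : ℝ)⁻¹ := by positivity
    have hbound := lintegral_excess_rpow_le (q := q) hp ha hε hδ (hmeas 0) (hmeasM 0)
      fun x hx => measure_biSup_abs_partialSum_ge_le_of_card (μ := μ) (hk1 0) (Y := X 0) (hmle 0)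
        hq0.le (hε.trans_le hx)
    have hR0 : R (3 * k 0 : ℝ)⁻¹ 0 ≠ ⊤ := fun h =>
      ENNReal.ne_top_of_tsum_ne_top (hRsum _ ha) 0 (by rw [h, ENNReal.mul_top (hc0 0)])
    refine ENNReal.mul_ne_top ENNReal.ofReal_ne_top (ne_top_of_le_ne_top ?_ hbound)
    exact ENNReal.add_ne_top.mpr ⟨ENNReal.mul_ne_top ENNReal.one_ne_top hR0,
      ENNReal.mul_ne_top (ENNReal.rpow_ne_top_of_nonneg hq0.le ENNReal.ofReal_ne_top) hJtop⟩
  set a := min 1 (C₁ / (8 * q))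
  have ha : 0 < a := lt_min one_pos (by positivity)
  set A : ENNReal := 1 + ENNReal.ofReal Ca * ENNReal.ofReal (1 + 8 * q * max 1 (δ / ε) / C₁)
  set B : ENNReal := 2 ^ q + ENNReal.ofReal Cb *
    (ENNReal.ofReal (8 * q / C₂ * (1 / ε + max 1 (δ / ε))) ^ q * 2 ^ (q - 1))
  have hA : A ≠ ⊤ := ENNReal.add_ne_top.mpr ⟨ENNReal.one_ne_top,
    ENNReal.mul_ne_top ENNReal.ofReal_ne_top ENNReal.ofReal_ne_top⟩
  have hB : B ≠ ⊤ := ENNReal.add_ne_top.mpr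
    ⟨ENNReal.rpow_ne_top_of_nonneg hq0.le ENNReal.ofNat_ne_top,
      ENNReal.mul_ne_top ENNReal.ofReal_ne_top (ENNReal.mul_ne_top
        (ENNReal.rpow_ne_top_of_nonneg hq0.le ENNReal.ofReal_ne_top)
        (ENNReal.rpow_ne_top_of_nonneg (by linarith) ENNReal.ofNat_ne_top))⟩
  have hFn : ∀ n, 1 ≤ n → F n ≤ A * (ENNReal.ofReal (c n) * R a n)
      + B * J * (ENNReal.ofReal (c n * V n ^ q) + ENNReal.ofReal (c n) * W n ^ q) := by
    intro n hn
    have hbound := lintegral_excess_rpow_le (q := q) (A := A)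
      (B := B * (ENNReal.ofReal (V n) ^ q + W n ^ q)) hp ha hε hδ (hmeas n) (hmeasM n)
      fun x hx => by
        refine (measure_biSup_abs_partialSum_ge_le (hk1 n) (hmeas n) hC₁ hC₂ (hmax n hn) hδ hε hq1
          (fun j hj => (ENNReal.sum_ne_top.mp (hWfin n)) j hj) hx).trans ?_
        have h1 : α n ≤ Ca := (le_abs_self _).trans (hCa n)
        have h2 : β n ≤ Cb := (le_abs_self _).trans (hCb n)
        simp only [A, B]
        gcongr
    calc F n ≤ ENNReal.ofReal (c n) * (A * R a n
          + B * (ENNReal.ofReal (V n) ^ q + W n ^ q) * J) := mul_le_mul_right hbound _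
      _ = _ := by
        rw [ENNReal.ofReal_mul (hc n).le, ← ENNReal.ofReal_rpow_of_nonneg (hV0 n) hq0.le]
        ring
  have hFn' : ∀ n, F n ≤ (if n = 0 then F 0 else 0) + (A * (ENNReal.ofReal (c n) * R a n)
      + B * J * (ENNReal.ofReal (c n * V n ^ q) + ENNReal.ofReal (c n) * W n ^ q)) := by
    intro n
    rcases Nat.eq_zero_or_pos n with rfl | hn
    · simp
    · exact (hFn n hn).trans le_add_self
  refine lt_of_le_of_lt (ENNReal.tsum_le_tsum hFn') (Ne.lt_top ?_)
  rw [ENNReal.tsum_add, tsum_ite_eq, ENNReal.tsum_add, ENNReal.tsum_mul_left,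
    ENNReal.tsum_mul_left, ENNReal.tsum_add]
  exact ENNReal.add_ne_top.mpr ⟨hF0, ENNReal.add_ne_top.mpr ⟨ENNReal.mul_ne_top hA (hRsum a ha),
    ENNReal.mul_ne_top (ENNReal.mul_ne_top hB hJtop)
      (ENNReal.add_ne_top.mpr ⟨hd₁.ne, hd₂.ne⟩)⟩⟩
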